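/- arXiv:2304.13822 — 2 statements merged into one kernel-verified Lean document; each statement's English description precedes it below -/
import Mathlib

section
/- Let Ω ⊂ ℝ⁴ be a bounded domain with smooth boundary, let λ₁, λ₂ ∈ ℝ, μ₁, μ₂ > 0, θ₁, θ₂ ∈ ℝ and β > 0. Assume that (λ₁, μ₁, θ₁) ∈ Σ₂ or (λ₂, μ₂, θ₂) ∈ Σ₂, where Σ₂ := {(λ, μ, θ) : θ < 0, μ > 0, and |θ| + θ·log|θ| − θ·log μ + λ − λ₁(Ω) ≥ 0}. Then the system −Δu = λ₁u + μ₁|u|²u + β|v|²u + θ₁u·log(u²), −Δv = λ₂v + μ₂|v|²v + β|u|²v + θ₂v·log(v²) in Ω, with u = v = 0 on ∂Ω, has no positive solution. -/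
open MeasureTheory

noncomputable section

/-- The space `ℝ⁴`, with its Lebesgue measure. -/
abbrev E4 : Type := EuclideanSpace ℝ (Fin 4)

/-- `C_c^∞(Ω)`: smooth real-valued functions with compact support contained in `Ω`. -/
def TestFun (Ω : Set E4) (u : E4 → ℝ) : Prop :=
  ContDiff ℝ (⊤ : ℕ∞) u ∧ HasCompactSupport u ∧ tsupport u ⊆ Ω

/-- The squared norm `|∇u|²` of the gradient. -/
def gradSq (u : E4 → ℝ) (x : E4) : ℝ := ‖fderiv ℝ u x‖ ^ 2

/-- The first Dirichlet eigenvalue `λ₁(Ω)` of `−Δ` on `Ω`, as the infimum of the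
Rayleigh quotient over test functions. -/
def lamOne (Ω : Set E4) : ℝ :=
  sInf { r : ℝ | ∃ w : E4 → ℝ, TestFun Ω w ∧ w ≠ 0 ∧
    r = (∫ x in Ω, gradSq w x) / (∫ x in Ω, (w x) ^ 2) }

/-- The Laplacian `Δu = ∑ᵢ ∂²u/∂xᵢ²` on `ℝ⁴`. -/
def lap (u : E4 → ℝ) (x : E4) : ℝ :=
  ∑ i : Fin 4,
    fderiv ℝ (fun y => fderiv ℝ u y (EuclideanSpace.single i (1 : ℝ))) x
      (EuclideanSpace.single i (1 : ℝ))

/-- A positive (classical) solution of the coupled logarithmic system: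
`u, v ∈ C²(Ω) ∩ C¹(Ω̄)`, `u, v > 0` in `Ω`, `u = v = 0` on `∂Ω`, and the equations
`−Δu = λ₁u + μ₁|u|²u + β|v|²u + θ₁u log u²`,
`−Δv = λ₂v + μ₂|v|²v + β|u|²v + θ₂v log v²` hold pointwise in `Ω`. -/
def IsPositiveSolution (Ω : Set E4) (lam1 mu1 th1 lam2 mu2 th2 β : ℝ)
    (u v : E4 → ℝ) : Prop :=
  ContDiffOn ℝ 2 u Ω ∧ ContDiffOn ℝ 1 u (closure Ω) ∧
  ContDiffOn ℝ 2 v Ω ∧ ContDiffOn ℝ 1 v (closure Ω) ∧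
  (∀ x ∈ Ω, 0 < u x) ∧ (∀ x ∈ Ω, 0 < v x) ∧
  (∀ x ∈ frontier Ω, u x = 0 ∧ v x = 0) ∧
  (∀ x ∈ Ω, -lap u x =
    lam1 * u x + mu1 * |u x| ^ 2 * u x + β * |v x| ^ 2 * u x +
      th1 * u x * Real.log ((u x) ^ 2)) ∧
  (∀ x ∈ Ω, -lap v x =
    lam2 * v x + mu2 * |v x| ^ 2 * v x + β * |u x| ^ 2 * v x +
      th2 * v x * Real.log ((v x) ^ 2))

lemma sob2 (M : ℝ) (hM : 0 < M) : ∃ δ : ENNReal, 0 < δ ∧ ∀ (w : E4 → ℝ) (S : Set E4),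
    ContDiff ℝ 1 w → HasCompactSupport w → Function.support w ⊆ S → volume S ≤ δ →
    M * ∫ x, (w x) ^ 2 ≤ ∫ x, gradSq w x := by
  set C0 : ℝ := ((SNormLESNormFDerivOfEqConst ℝ (volume : Measure E4) 2 : NNReal) : ℝ) with hC0
  have hC0n : 0 ≤ C0 := NNReal.coe_nonneg _
  set k : ℝ := 1 / (M * (C0 ^ 2 + 1)) with hk
  have hkpos : 0 < k := by positivity
  refine ⟨ENNReal.ofReal (k ^ 2), by simp; positivity, ?_⟩
  intro w S hw hwc hwS hS
  have hwi : Integrable (fun x => (w x) ^ 2) :=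
    (hw.continuous.pow 2).integrable_of_hasCompactSupport (by
      simpa [pow_two] using hwc.mul_left (f' := w))
  have hdc : Continuous (fderiv ℝ w) := hw.continuous_fderiv (by norm_num)
  have hds : HasCompactSupport (fderiv ℝ w) := hwc.fderiv (𝕜 := ℝ)
  have hm1 : MemLp w 2 (volume : Measure E4) := hw.continuous.memLp_of_hasCompactSupport hwc
  have hm2 : MemLp (fderiv ℝ w) 2 (volume : Measure E4) := hdc.memLp_of_hasCompactSupport hds
  have e1 := hm1.eLpNorm_eq_integral_rpow_norm (by norm_num) (by norm_num)
  have e2 := hm2.eLpNorm_eq_integral_rpow_norm (by norm_num) (by norm_num)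
  have g := eLpNorm_le_eLpNorm_fderiv_of_eq (volume : Measure E4) hw hwc (p := 2) (p' := 4) (by norm_num) (by simp)
    (by simp; norm_num)
  have h := eLpNorm_le_eLpNorm_mul_rpow_measure_univ (μ := volume.restrict S) (p := 2) (q := 4)
    (f := w) (by norm_num) hw.continuous.aestronglyMeasurable
  rw [eLpNorm_restrict_eq_of_support_subset hwS, eLpNorm_restrict_eq_of_support_subset hwS] at h
  simp only [Measure.restrict_apply_univ] at h
  set a := ∫ x, (w x) ^ 2 with ha
  set b := ∫ x, gradSq w x with hb
  have ha0 : 0 ≤ a := integral_nonneg fun x => sq_nonneg _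
  have hb0 : 0 ≤ b := integral_nonneg fun x => sq_nonneg _
  have e1' : eLpNorm w 2 (volume : Measure E4) = ENNReal.ofReal (√a) := by
    rw [e1, Real.sqrt_eq_rpow, ha]; simp
  have e2' : eLpNorm (fderiv ℝ w) 2 (volume : Measure E4) = ENNReal.ofReal (√b) := by
    rw [e2, Real.sqrt_eq_rpow, hb]; simp [gradSq]
  have hpow : volume S ^ (1 / (2 : ENNReal).toReal - 1 / (4 : ENNReal).toReal) ≤
      ENNReal.ofReal (√ k) := by
    refine (ENNReal.rpow_le_rpow hS (by norm_num)).trans ?_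
    rw [ENNReal.ofReal_rpow_of_pos (by positivity)]
    apply ENNReal.ofReal_le_ofReal
    rw [Real.sqrt_eq_rpow, ← Real.rpow_natCast, ← Real.rpow_mul hkpos.le]
    norm_num
  have key : ENNReal.ofReal (√a) ≤ ENNReal.ofReal (C0 * √b * √k) := by
    rw [ENNReal.ofReal_mul (by positivity), ENNReal.ofReal_mul hC0n, ← e1', ← e2']
    refine h.trans ?_
    gcongr
    refine le_trans (by simpa using g) ?_
    rw [hC0, ENNReal.ofReal_coe_nnreal]
  rw [ENNReal.ofReal_le_ofReal_iff (by positivity)] at key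
  have key2 : a ≤ C0 ^ 2 * b * k := by
    have := pow_le_pow_left₀ (Real.sqrt_nonneg a) key 2
    rw [mul_pow, mul_pow, Real.sq_sqrt ha0, Real.sq_sqrt hb0, Real.sq_sqrt hkpos.le] at this
    exact this
  calc M * a ≤ M * (C0 ^ 2 * b * k) := by gcongr
    _ = (C0 ^ 2 / (C0 ^ 2 + 1)) * b := by rw [hk]; field_simp
    _ ≤ 1 * b := by
      gcongr
      rw [div_le_one (by positivity)]; linarith
    _ = b := one_mul b

lemma sum_sq_le (L : E4 →L[ℝ] ℝ) :
    ∑ i : Fin 4, (L (EuclideanSpace.single i (1 : ℝ))) ^ 2 ≤ ‖L‖ ^ 2 := by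
  set S := ∑ i : Fin 4, (L (EuclideanSpace.single i (1 : ℝ))) ^ 2 with hS
  have hS0 : 0 ≤ S := Finset.sum_nonneg fun i _ => sq_nonneg _
  let g : E4 := WithLp.toLp 2 (fun i => L (EuclideanSpace.single i (1 : ℝ)))
  have hg : ‖g‖ ^ 2 = S := by
    rw [EuclideanSpace.norm_sq_eq]; simp [g, hS]
  have hgs : g = ∑ i : Fin 4, (L (EuclideanSpace.single i (1 : ℝ))) • EuclideanSpace.single i (1 : ℝ) := by
    ext j
    simp [g, Pi.single_apply]
  have hL : L g = S := by
    rw [hgs, map_sum, hS]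
    refine Finset.sum_congr rfl fun i _ => ?_
    rw [map_smul, smul_eq_mul, pow_two]
  have h1 : S ≤ ‖L‖ * ‖g‖ := by
    rw [← hL]; exact (le_abs_self _).trans (L.le_opNorm g)
  by_cases h0 : ‖g‖ = 0
  · rw [← hg, h0]; simp
  · have : 0 < ‖g‖ := lt_of_le_of_ne (norm_nonneg _) (Ne.symm h0)
    rw [← hg] at h1 ⊢
    have : ‖g‖ ≤ ‖L‖ := by nlinarith
    gcongr

lemma int_fderiv_zero (F : E4 → ℝ) (hF : ContDiff ℝ 1 F) (hc : HasCompactSupport F) (e : E4) :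
    Integrable (fun x => fderiv ℝ F x e) ∧ ∫ x, fderiv ℝ F x e = 0 := by
  have hi : Integrable (fun x => fderiv ℝ F x e) := by
    apply Continuous.integrable_of_hasCompactSupport
    · exact (hF.continuous_fderiv (by norm_num)).clm_apply continuous_const
    · exact hc.fderiv_apply (𝕜 := ℝ) e
  refine ⟨hi, ?_⟩
  have := integral_mul_fderiv_eq_neg_fderiv_mul_of_integrable (μ := (volume : Measure E4))
    (f := fun _ : E4 => (1 : ℝ)) (g := F) (v := e) (by simp) (by simpa using hi)
    (by simpa using hF.continuous.integrable_of_hasCompactSupport hc) (by simp)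
    (fun x _ => hF.differentiable (by norm_num) x)
  simpa using this

lemma picone (Ω : Set E4) (hΩo : IsOpen Ω) (u φ : E4 → ℝ) (hu : ContDiffOn ℝ 2 u Ω)
    (hpos : ∀ x ∈ Ω, 0 < u x) (hφ : TestFun Ω φ) (V : E4 → ℝ)
    (hV : ∀ x ∈ Ω, V x * u x ≤ -lap u x) (hVi : Integrable (fun x => V x * φ x ^ 2)) :
    ∫ x, V x * φ x ^ 2 ≤ ∫ x, gradSq φ x := by
  obtain ⟨hφs, hφc, hφt⟩ := hφ
  have hφ1 : ContDiff ℝ 1 φ := hφs.of_le (by exact_mod_cast le_top)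
  let e : Fin 4 → E4 := fun i => EuclideanSpace.single i (1 : ℝ)
  let F : Fin 4 → E4 → ℝ := fun i x => φ x ^ 2 * (fderiv ℝ u x (e i) / u x)
  have hsub : ∀ i, Function.support (F i) ⊆ tsupport φ := by
    intro i x hx
    apply subset_tsupport
    intro h
    apply hx
    simp [F, h]
  have hts : ∀ i, tsupport (F i) ⊆ tsupport φ := fun i =>
    closure_minimal (hsub i) (isClosed_tsupport _)
  have hFc : ∀ i, HasCompactSupport (F i) := fun i =>
    HasCompactSupport.of_support_subset_isCompact hφc (hsub i)
  have hDu : ∀ i, ∀ x ∈ Ω, ContDiffAt ℝ 1 (fun y => fderiv ℝ u y (e i)) x := by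
    intro i x hx
    have h2 : ContDiffAt ℝ 2 u x := hu.contDiffAt (hΩo.mem_nhds hx)
    exact (h2.fderiv_right (m := 1) (by norm_num)).clm_apply contDiffAt_const
  have hua : ∀ x ∈ Ω, ContDiffAt ℝ 1 u x := fun x hx =>
    (hu.contDiffAt (hΩo.mem_nhds hx)).of_le (by norm_num)
  have hF : ∀ i, ContDiff ℝ 1 (F i) := by
    intro i
    rw [contDiff_iff_contDiffAt]
    intro x
    by_cases hx : x ∈ tsupport (F i)
    swap
    · exact contDiffAt_const.congr_of_eventuallyEq (notMem_tsupport_iff_eventuallyEq.1 hx)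
    have hxΩ := hφt (hts i hx)
    exact (hφ1.contDiffAt.pow 2).mul ((hDu i x hxΩ).div (hua x hxΩ) (hpos x hxΩ).ne')
  have hzero : ∫ x, ∑ i, fderiv ℝ (F i) x (e i) = 0 := by
    rw [integral_finsetSum _ fun i _ => (int_fderiv_zero (F i) (hF i) (hFc i) (e i)).1]
    exact Finset.sum_eq_zero fun i _ => (int_fderiv_zero (F i) (hF i) (hFc i) (e i)).2
  have hgi : Integrable (fun x => gradSq φ x) := by
    apply Continuous.integrable_of_hasCompactSupport
    · exact ((hφ1.continuous_fderiv (by norm_num)).norm).pow 2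
    · have := hφc.fderiv (𝕜 := ℝ)
      exact this.comp_left (g := fun L => ‖L‖ ^ 2) (by simp)
  have hpt : ∀ x, ∑ i, fderiv ℝ (F i) x (e i) ≤ gradSq φ x - V x * φ x ^ 2 := by
    intro x
    by_cases hx : x ∈ tsupport φ
    · have hxΩ := hφt hx
      have hux := hpos x hxΩ
      have hi : ∀ i, fderiv ℝ (F i) x (e i) ≤ (fderiv ℝ φ x (e i)) ^ 2 +
          φ x ^ 2 / u x * fderiv ℝ (fun y => fderiv ℝ u y (e i)) x (e i) := by
        intro i
        have h1 : HasFDerivAt φ (fderiv ℝ φ x) x := (hφ1.differentiable (by norm_num) x).hasFDerivAt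
        have h2 : HasFDerivAt u (fderiv ℝ u x) x :=
          ((hua x hxΩ).differentiableAt (by norm_num)).hasFDerivAt
        have h3 : HasFDerivAt (fun y => fderiv ℝ u y (e i))
          (fderiv ℝ (fun y => fderiv ℝ u y (e i)) x) x :=
          ((hDu i x hxΩ).differentiableAt (by norm_num)).hasFDerivAt
        have h4 := (h1.pow 2).mul (h3.mul ((hasDerivAt_inv hux.ne').comp_hasFDerivAt x h2))
        have h5 : fderiv ℝ (F i) x = _ := HasFDerivAt.fderiv (f := F i) h4
        rw [h5]
        simp only [add_apply, smul_apply, smul_eq_mul, Pi.mul_apply,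
          Function.comp_apply]
        set p := fderiv ℝ φ x (e i)
        set q := fderiv ℝ u x (e i)
        set r := fderiv ℝ (fun y => fderiv ℝ u y (e i)) x (e i)
        have : 0 ≤ (p - φ x * q / u x) ^ 2 := sq_nonneg _
        rw [← sub_nonneg]
        convert this using 1
        field_simp
        ring
      have hs := Finset.sum_le_sum fun i (_ : i ∈ Finset.univ) => hi i
      rw [Finset.sum_add_distrib, ← Finset.mul_sum] at hs
      have hl : ∑ i, fderiv ℝ (fun y => fderiv ℝ u y (e i)) x (e i) = lap u x := rfl
      rw [hl] at hs
      have h6 := sum_sq_le (fderiv ℝ φ x)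
      have h7 : φ x ^ 2 / u x * lap u x ≤ φ x ^ 2 / u x * (-(V x * u x)) := by
        gcongr
        linarith [hV x hxΩ]
      have h8 : φ x ^ 2 / u x * (-(V x * u x)) = - (V x * φ x ^ 2) := by
        field_simp
      unfold gradSq
      linarith
    · have h0 : φ x = 0 := image_eq_zero_of_notMem_tsupport hx
      have : ∀ i, fderiv ℝ (F i) x = 0 := fun i => by
        by_contra h
        exact hx (hts i (support_fderiv_subset ℝ h))
      simp only [this, h0, gradSq]
      simp
  have := integral_mono (integrable_finsetSum _ fun i _ =>
    (int_fderiv_zero (F i) (hF i) (hFc i) (e i)).1) (hgi.sub hVi) hpt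
  rw [hzero] at this
  have h9 := integral_sub hgi hVi
  simp only [Pi.sub_apply] at this
  linarith

lemma hint2 (g : E4 → ℝ) (hg : ContDiff ℝ 1 g) (hgc : HasCompactSupport g) :
    Integrable (fun x => g x ^ 2) := by
  have h : HasCompactSupport (fun x => g x ^ 2) := by
    simp only [pow_two]
    exact hgc.mul_left (f' := g)
  exact (hg.continuous.pow 2).integrable_of_hasCompactSupport h

lemma hintg (g : E4 → ℝ) (hg : ContDiff ℝ 1 g) (hgc : HasCompactSupport g) :
    Integrable (fun x => gradSq g x) := by
  apply Continuous.integrable_of_hasCompactSupport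
  · exact ((hg.continuous_fderiv (by norm_num)).norm).pow 2
  · exact (hgc.fderiv (𝕜 := ℝ)).comp_left (g := fun L => ‖L‖ ^ 2) (by simp)

lemma core (Ω : Set E4) (hΩne : Ω.Nonempty) (hΩo : IsOpen Ω)
    (hΩb : Bornology.IsBounded Ω) (β : ℝ) (hβ : 0 < β) (u v : E4 → ℝ)
    (hu : ContDiffOn ℝ 2 u Ω) (hv : ContinuousOn v Ω)
    (hup : ∀ x ∈ Ω, 0 < u x) (hvp : ∀ x ∈ Ω, 0 < v x)
    (hl : ∀ x ∈ Ω, (lamOne Ω + β * v x ^ 2) * u x ≤ -lap u x) : False := by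
  set l := lamOne Ω with hldef
  set M := 2 * |l| + 2 with hM
  have hM0 : 0 < M := by positivity
  have hMl : 1 ≤ M / 2 - l := by rw [hM]; linarith [le_abs_self l]
  obtain ⟨δ, hδ, hsob⟩ := sob2 M hM0
  obtain ⟨K, hKΩ, hK, hKδ⟩ := hΩo.measurableSet.exists_isCompact_sdiff_lt
    (μ := volume) hΩb.measure_lt_top.ne hδ.ne'
  obtain ⟨L, hL, hKL, hLΩ⟩ := exists_compact_between hK hΩo hKΩ
  obtain ⟨η, hηs, hηr, hηsupp, hη1⟩ := exists_contMDiff_support_eq_eq_one_iff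
    (n := (⊤ : ℕ∞)) (modelWithCornersSelf ℝ E4) isOpen_interior hK.isClosed hKL
  replace hηs : ContDiff ℝ (⊤ : ℕ∞) η := hηs.contDiff
  have hη0 : ∀ x, x ∉ L → η x = 0 := by
    intro x hx
    by_contra h
    have : x ∈ Function.support η := h
    rw [hηsupp] at this
    exact hx (interior_subset this)
  have hηI : ∀ x, 0 ≤ η x ∧ η x ≤ 1 := fun x => hηr ⟨x, rfl⟩
  have hηc : HasCompactSupport η :=
    HasCompactSupport.of_support_subset_isCompact hL (hηsupp ▸ interior_subset)
  have hηt : tsupport η ⊆ L := closure_minimal (hηsupp ▸ interior_subset) hL.isClosed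
  have hη1' : ContDiff ℝ 1 η := hηs.of_le (by exact_mod_cast le_top)
  have hηd0 : ∀ x, x ∉ L → fderiv ℝ η x = 0 := by
    intro x hx
    by_contra h
    exact hx (hηt (support_fderiv_subset ℝ h))
  obtain ⟨C, hC⟩ := (hηc.fderiv (𝕜 := ℝ)).exists_bound_of_continuous
    (hη1'.continuous_fderiv (by norm_num))
  obtain ⟨c, hc, hcv⟩ : ∃ c : ℝ, 0 < c ∧ ∀ x ∈ L, c ≤ β * v x ^ 2 := by
    rcases L.eq_empty_or_nonempty with h | h
    · exact ⟨1, one_pos, by simp [h]⟩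
    · obtain ⟨x0, hx0, hmin⟩ := hL.exists_isMinOn h
        (f := fun x => β * v x ^ 2) (continuousOn_const.mul ((hv.mono hLΩ).pow 2))
      refine ⟨β * v x0 ^ 2, ?_, fun x hx => hmin hx⟩
      have := hvp x0 (hLΩ hx0)
      positivity
  set D := M / 2 + C ^ 2 with hD
  have hD0 : 0 < D := by positivity
  set ε := c * (M / 2 - l) / (c + D) with hε
  have hε0 : 0 < ε := by
    have : 0 < M / 2 - l := by linarith
    positivity
  have claim : ∀ φ, TestFun Ω φ → (l + ε) * ∫ x, φ x ^ 2 ≤ ∫ x, gradSq φ x := by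
    intro φ hφ
    obtain ⟨hφs, hφc, hφt⟩ := id hφ
    have hφ1 : ContDiff ℝ 1 φ := hφs.of_le (by exact_mod_cast le_top)
    have hi := hint2 φ hφ1 hφc
    have hiL : Integrable (L.indicator fun x => φ x ^ 2) := hi.indicator hL.measurableSet
    set N := ∫ x, φ x ^ 2 with hN
    set A := ∫ x, gradSq φ x with hA
    set B := ∫ x, L.indicator (fun x => φ x ^ 2) x with hB
    have hB0 : 0 ≤ B := integral_nonneg fun x => Set.indicator_nonneg (fun _ _ => sq_nonneg _) x
    -- Picone
    have s1 : l * N + c * B ≤ A := by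
      have hVeq : (fun x => (l + L.indicator (fun _ => c) x) * φ x ^ 2) =
          fun x => l * φ x ^ 2 + c * L.indicator (fun x => φ x ^ 2) x := by
        ext x
        by_cases hx : x ∈ L <;> simp [hx, add_mul]
      have hp := picone Ω hΩo u φ hu hup hφ (fun x => l + L.indicator (fun _ => c) x) (by
        intro x hx
        refine le_trans ?_ (hl x hx)
        have := (hup x hx).le
        gcongr
        by_cases hxL : x ∈ L
        · simpa [hxL] using hcv x hxL
        · simp only [hxL, not_false_eq_true, Set.indicator_of_notMem]
          positivity) (by
        simp only [hVeq]
        exact (hi.const_mul l).add (hiL.const_mul c))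
      simp only [hVeq] at hp
      rw [integral_add (hi.const_mul l) (hiL.const_mul c), integral_const_mul,
        integral_const_mul] at hp
      exact hp
    -- Cutoff
    let w : E4 → ℝ := fun x => (1 - η x) * φ x
    have hw1 : ContDiff ℝ 1 w := (contDiff_const.sub hη1').mul hφ1
    have hwc : HasCompactSupport w := hφc.mul_left
    have hwS : Function.support w ⊆ Ω \ K := by
      intro x hx
      refine ⟨hφt (subset_tsupport _ fun h => hx (by simp [w, h])), fun h => hx ?_⟩
      simp [w, (hη1 x).1 h]
    have s2 := hsob w _ hw1 hwc hwS hKδ.le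
    have s3 : N - B ≤ ∫ x, w x ^ 2 := by
      rw [hN, hB, ← integral_sub hi hiL]
      refine integral_mono (hi.sub hiL) (hint2 w hw1 hwc) fun x => ?_
      by_cases hx : x ∈ L
      · simp [hx, sq_nonneg]
      · simp [hx, w, hη0 x hx]
    have s4 : ∫ x, gradSq w x ≤ 2 * A + 2 * C ^ 2 * B := by
      have hI := (hintg φ hφ1 hφc).const_mul 2
      have hJ := hiL.const_mul (2 * C ^ 2)
      rw [hA, hB, ← integral_const_mul, ← integral_const_mul, ← integral_add hI hJ]
      refine integral_mono (hintg w hw1 hwc) (hI.add hJ) fun x => ?_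
      have h1 : HasFDerivAt φ (fderiv ℝ φ x) x := (hφ1.differentiable (by norm_num) x).hasFDerivAt
      have h2 : HasFDerivAt η (fderiv ℝ η x) x := (hη1'.differentiable (by norm_num) x).hasFDerivAt
      have h3 : fderiv ℝ w x = _ := HasFDerivAt.fderiv (f := w) ((h2.const_sub 1).mul h1)
      have h4 : ‖fderiv ℝ w x‖ ≤ ‖fderiv ℝ φ x‖ + |φ x| * ‖fderiv ℝ η x‖ := by
        rw [h3]
        refine (norm_add_le _ _).trans ?_
        rw [norm_smul, norm_smul, norm_neg]
        gcongr
        · refine mul_le_of_le_one_left (norm_nonneg _) ?_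
          rw [Real.norm_eq_abs, abs_le]
          constructor <;> linarith [hηI x]
        · exact le_of_eq (Real.norm_eq_abs _)
      have h5 : (|φ x| * ‖fderiv ℝ η x‖) ^ 2 ≤ C ^ 2 * L.indicator (fun x => φ x ^ 2) x := by
        by_cases hx : x ∈ L
        · simp only [hx, Set.indicator_of_mem]
          rw [mul_pow, sq_abs, mul_comm]
          gcongr
          exact hC x
        · simp [hx, hηd0 x hx]
      have h6 : ‖fderiv ℝ w x‖ ^ 2 ≤ (‖fderiv ℝ φ x‖ + |φ x| * ‖fderiv ℝ η x‖) ^ 2 := by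
        gcongr
      simp only [gradSq]
      nlinarith [sq_nonneg (‖fderiv ℝ φ x‖ - |φ x| * ‖fderiv ℝ η x‖)]
    have s5 : M * (N - B) ≤ 2 * A + 2 * C ^ 2 * B :=
      (mul_le_mul_of_nonneg_left s3 hM0.le).trans (s2.trans s4)
    have s6 : M / 2 * N - D * B ≤ A := by rw [hD]; linarith
    have s7 : (c + D) * ((l + ε) * N) ≤ (c + D) * A := by
      have : (c + D) * ((l + ε) * N) = D * (l * N + c * B) + c * (M / 2 * N - D * B) := by
        rw [hε]; field_simp; ring
      rw [this]
      have k1 := mul_le_mul_of_nonneg_left s1 hD0.le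
      have k2 := mul_le_mul_of_nonneg_left s6 hc.le
      linarith
    exact le_of_mul_le_mul_left s7 (by positivity)
  have hfin : l + ε ≤ lamOne Ω := by
    unfold lamOne
    apply le_csInf
    · obtain ⟨x0, hx0⟩ := hΩne
      obtain ⟨f, hft, hfc, hfs, -, hf1⟩ := exists_contDiff_tsupport_subset
        (n := (⊤ : ℕ∞)) (hΩo.mem_nhds hx0)
      refine ⟨_, f, ⟨hfs, hfc, hft⟩, ?_, rfl⟩
      intro h
      rw [h] at hf1
      simp at hf1
    · rintro r ⟨w, hw, hw0, rfl⟩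
      obtain ⟨hws, hwc, hwt⟩ := id hw
      obtain ⟨x0, hx0⟩ := Function.ne_iff.1 hw0
      have hout : ∀ x, x ∉ Ω → x ∉ tsupport w := fun x hx h => hx (hwt h)
      rw [setIntegral_eq_integral_of_forall_compl_eq_zero (f := fun x => w x ^ 2)
          (fun x hx => by simp [image_eq_zero_of_notMem_tsupport (hout x hx)]),
        setIntegral_eq_integral_of_forall_compl_eq_zero (f := fun x => gradSq w x)
          (fun x hx => by
            have : fderiv ℝ w x = 0 := by
              by_contra h
              exact hout x hx (support_fderiv_subset ℝ h)
            simp [gradSq, this])]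
      have hpos : 0 < ∫ x, w x ^ 2 :=
        (hws.continuous.pow 2).integral_pos_of_hasCompactSupport_nonneg_nonzero (x := x0)
          (hwc.comp_left (g := fun t : ℝ => t ^ 2) (by simp)) (fun x => sq_nonneg _)
          (by simpa using hx0)
      rw [le_div_iff₀ hpos]
      exact claim w hw
  linarith

lemma min_ineq (μ θ s : ℝ) (hμ : 0 < μ) (hθ : θ < 0) (hs : 0 < s) :
    |θ| + θ * Real.log |θ| - θ * Real.log μ ≤ μ * s + θ * Real.log s := by
  rw [abs_of_neg hθ]
  set t := -θ with ht
  have ht0 : 0 < t := by linarith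
  have hθt : θ = -t := by simp [ht]
  have h := Real.log_le_sub_one_of_pos (x := μ * s / t) (by positivity)
  rw [Real.log_div (by positivity) ht0.ne', Real.log_mul hμ.ne' hs.ne'] at h
  have h2 := mul_le_mul_of_nonneg_left h ht0.le
  have h3 : t * (μ * s / t - 1) = μ * s - t := by field_simp
  rw [h3] at h2
  rw [hθt]
  nlinarith

lemma half (Ω : Set E4) (hΩne : Ω.Nonempty) (hΩo : IsOpen Ω)
    (hΩb : Bornology.IsBounded Ω) (lam μ θ β : ℝ) (hμ : 0 < μ) (hβ : 0 < β) (hθ : θ < 0)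
    (h : |θ| + θ * Real.log |θ| - θ * Real.log μ + lam - lamOne Ω ≥ 0) (u v : E4 → ℝ)
    (hu : ContDiffOn ℝ 2 u Ω) (hv : ContinuousOn v Ω)
    (hup : ∀ x ∈ Ω, 0 < u x) (hvp : ∀ x ∈ Ω, 0 < v x)
    (heq : ∀ x ∈ Ω, -lap u x = lam * u x + μ * |u x| ^ 2 * u x + β * |v x| ^ 2 * u x +
      θ * u x * Real.log ((u x) ^ 2)) : False := by
  refine core Ω hΩne hΩo hΩb β hβ u v hu hv hup hvp fun x hx => ?_
  have h1 := min_ineq μ θ (u x ^ 2) hμ hθ (by have := hup x hx; positivity)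
  rw [heq x hx, sq_abs, sq_abs]
  have h2 : lamOne Ω + β * v x ^ 2 ≤
      lam + μ * u x ^ 2 + β * v x ^ 2 + θ * Real.log (u x ^ 2) := by linarith
  have := mul_le_mul_of_nonneg_right h2 (hup x hx).le
  linarith

/-- Theorem 1.7 of the paper: if `β > 0` and `(λ₁,μ₁,θ₁) ∈ Σ₂` or `(λ₂,μ₂,θ₂) ∈ Σ₂`,
where `Σ₂ = {(λ,μ,θ) : θ < 0, μ > 0, |θ| + θ log|θ| − θ log μ + λ − λ₁(Ω) ≥ 0}`, then
the system has no positive solution in the bounded domain `Ω`. -/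
theorem stmt_18 (Ω : Set E4) (hΩne : Ω.Nonempty) (hΩo : IsOpen Ω)
    (hΩb : Bornology.IsBounded Ω) (hΩc : IsConnected Ω)
    (lam1 lam2 μ₁ μ₂ θ₁ θ₂ β : ℝ) (hμ₁ : 0 < μ₁) (hμ₂ : 0 < μ₂) (hβ : 0 < β)
    (hSigma :
      (θ₁ < 0 ∧ 0 < μ₁ ∧
        |θ₁| + θ₁ * Real.log |θ₁| - θ₁ * Real.log μ₁ + lam1 - lamOne Ω ≥ 0) ∨
      (θ₂ < 0 ∧ 0 < μ₂ ∧
        |θ₂| + θ₂ * Real.log |θ₂| - θ₂ * Real.log μ₂ + lam2 - lamOne Ω ≥ 0)) :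
    ¬ ∃ u v : E4 → ℝ, IsPositiveSolution Ω lam1 μ₁ θ₁ lam2 μ₂ θ₂ β u v := by
  rintro ⟨u, v, hu, -, hv, -, hup, hvp, -, he1, he2⟩
  rcases hSigma with ⟨hθ, -, h⟩ | ⟨hθ, -, h⟩
  · exact half Ω hΩne hΩo hΩb lam1 μ₁ θ₁ β hμ₁ hβ hθ h u v hu hv.continuousOn hup hvp he1
  · exact half Ω hΩne hΩo hΩb lam2 μ₂ θ₂ β hμ₂ hβ hθ h v u hv hu.continuousOn hvp hup he2
end
end

section
/- Let Ω ⊂ ℝ⁴ be a bounded domain with smooth boundary, let λ₁, λ₂ ∈ ℝ, μ₁ < μ₂, μ₁ < β < μ₂, θ₂ < 0 < θ₁, and assume −θ₁·log(θ₁/(β−μ₁)) + θ₂·log(θ₂/(β−μ₂)) + θ₁ − θ₂ + λ₂ − λ₁ > 0. Then the system −Δu = λ₁u + μ₁|u|²u + β|v|²u + θ₁u·log(u²), −Δv = λ₂v + μ₂|v|²v + β|u|²v + θ₂v·log(v²) in Ω, with u = v = 0 on ∂Ω, has no positive solution. -/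
open MeasureTheory

noncomputable section

open Filter Topology Set in
lemma aux_grad_bound (Ω : Set E4) (hΩo : IsOpen Ω) (hΩb : Bornology.IsBounded Ω) (u : E4 → ℝ)
    (hu : ContDiffOn ℝ 1 u (closure Ω)) : ∃ M, ∀ x ∈ Ω, ‖fderiv ℝ u x‖ ≤ M := by
  have hK : IsCompact (closure Ω) := hΩb.isCompact_closure
  have key : ∃ M, ∀ x ∈ closure Ω, x ∈ Ω → ‖fderiv ℝ u x‖ ≤ M := by
    refine hK.induction_on (p := fun s => ∃ M, ∀ x ∈ s, x ∈ Ω → ‖fderiv ℝ u x‖ ≤ M) ?_ ?_ ?_ ?_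
    · exact ⟨0, by simp⟩
    · rintro s t hst ⟨M, hM⟩
      exact ⟨M, fun x hx => hM x (hst hx)⟩
    · rintro s t ⟨M, hM⟩ ⟨M', hM'⟩
      refine ⟨max M M', ?_⟩
      rintro x (hx | hx) hxΩ
      · exact (hM x hx hxΩ).trans (le_max_left _ _)
      · exact (hM' x hx hxΩ).trans (le_max_right _ _)
    · intro x hx
      have h1 : ContDiffWithinAt ℝ (0 + 1) u (closure Ω) x := by simpa using hu x hx
      obtain ⟨w, hw, -, f', hf', hc⟩ :=
        (contDiffWithinAt_succ_iff_hasFDerivWithinAt (by simp)).1 h1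
      rw [insert_eq_of_mem hx] at hw
      have hcont : ContinuousWithinAt f' w x := hc.continuousWithinAt
      have hb : ∀ᶠ y in 𝓝[w] x, ‖f' y‖ < ‖f' x‖ + 1 :=
        hcont.norm.eventually (gt_mem_nhds (by linarith))
      have hb' : ∀ᶠ y in 𝓝[closure Ω] x, ‖f' y‖ < ‖f' x‖ + 1 :=
        hb.filter_mono (nhdsWithin_le_of_mem hw)
      have hw' : ∀ᶠ y in 𝓝[closure Ω] x, w ∈ 𝓝[closure Ω] y :=
        eventually_eventually_nhdsWithin.2 hw
      refine ⟨_, hb'.and (hw'.and hw), ‖f' x‖ + 1, ?_⟩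
      rintro y ⟨hy1, hy2, hy3⟩ hyΩ
      have hn : closure Ω ∈ 𝓝 y := mem_of_superset (hΩo.mem_nhds hyΩ) subset_closure
      rw [nhdsWithin_eq_nhds.2 hn] at hy2
      rw [((hf' y hy3).hasFDerivAt hy2).fderiv]
      exact hy1.le
  obtain ⟨M, hM⟩ := key
  exact ⟨M, fun x hx => hM x (subset_closure hx) hx⟩

lemma aux_div_zero (g : E4 → ℝ) (hg : ContDiff ℝ 1 g) (hc : HasCompactSupport g) (e : E4) :
    Integrable (fun x => fderiv ℝ g x e) ∧ ∫ x, fderiv ℝ g x e = 0 := by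
  have hcd : Continuous (fun x => fderiv ℝ g x e) :=
    (hg.continuous_fderiv (by simp)).clm_apply continuous_const
  have hcs : HasCompactSupport (fun x => fderiv ℝ g x e) := hc.fderiv_apply ℝ e
  have hi := hcd.integrable_of_hasCompactSupport (μ := volume) hcs
  have hig := hg.continuous.integrable_of_hasCompactSupport (μ := volume) hc
  refine ⟨hi, ?_⟩
  have := integral_mul_fderiv_eq_neg_fderiv_mul_of_integrable (μ := (volume : Measure E4))
    (f := fun _ : E4 => (1:ℝ)) (g := g) (v := e) (by simp) (by simpa using hi) (by simpa using hig)
    (fun x _ => differentiableAt_const _) (fun x _ => hg.differentiable (by simp) x)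
  simpa using this

/-- A cutoff on the line. -/
lemma aux_cutoff : ∃ (h h' : ℝ → ℝ) (C : ℝ), ContDiff ℝ 1 h ∧ Continuous h' ∧
    (∀ t, HasDerivAt h (h' t) t) ∧ (∀ t, 0 ≤ h t) ∧ (∀ t, h t ≤ 1) ∧ (∀ t, t ≤ 1 → h t = 0) ∧
    (∀ t, 2 ≤ t → h t = 1) ∧ (∀ t, 0 ≤ h' t) ∧ (∀ t, 2 < t → h' t = 0) ∧
    (∀ t, 0 ≤ t → t * h' t ≤ C) := by
  have hs : ContDiff ℝ 1 (fun t : ℝ => Real.smoothTransition (t - 1)) :=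
    (Real.smoothTransition.contDiff (n := 1)).comp (contDiff_id.sub contDiff_const)
  have hc : Continuous (deriv (fun t : ℝ => Real.smoothTransition (t - 1))) :=
    hs.continuous_deriv (by simp)
  have hm : Monotone (fun t : ℝ => Real.smoothTransition (t - 1)) := fun a b hab =>
    Real.smoothTransition.monotone (by linarith)
  have h2 : ∀ t : ℝ, 2 < t → deriv (fun t : ℝ => Real.smoothTransition (t - 1)) t = 0 := by
    intro t ht
    have : (fun t : ℝ => Real.smoothTransition (t - 1)) =ᶠ[nhds t] fun _ => 1 := by
      filter_upwards [lt_mem_nhds ht] with s hs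
      exact Real.smoothTransition.one_of_one_le (by linarith)
    rw [this.deriv_eq]; simp
  have h0 : ∀ t : ℝ, 0 ≤ deriv (fun t : ℝ => Real.smoothTransition (t - 1)) t := fun t =>
    hm.deriv_nonneg
  obtain ⟨C, hC⟩ := (isCompact_Icc (a := (0:ℝ)) (b := 2)).exists_bound_of_continuousOn
    (f := fun t => t * deriv (fun t : ℝ => Real.smoothTransition (t - 1)) t)
    (by fun_prop)
  refine ⟨_, _, C, hs, hc, fun t => (hs.differentiable (by simp) t).hasDerivAt,
    fun t => Real.smoothTransition.nonneg _, fun t => Real.smoothTransition.le_one _,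
    fun t ht => Real.smoothTransition.zero_of_nonpos (by linarith),
    fun t ht => Real.smoothTransition.one_of_one_le (by linarith), h0, h2, ?_⟩
  intro t ht
  rcases le_or_gt t 2 with h | h
  · exact (le_abs_self _).trans (hC t ⟨ht, h⟩)
  · rw [h2 t h, mul_zero]
    have := hC 0 (by simp)
    simpa using this

lemma aux_bracket (lam1 lam2 μ₁ μ₂ θ₁ θ₂ β : ℝ) (hβ1 : μ₁ < β) (hβ2 : β < μ₂)
    (hθ₂ : θ₂ < 0) (hθ₁ : 0 < θ₁) (s t : ℝ) (hs : 0 < s) (ht : 0 < t) :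
    -θ₁ * Real.log (θ₁ / (β - μ₁)) + θ₂ * Real.log (θ₂ / (β - μ₂)) +
        θ₁ - θ₂ + lam2 - lam1 ≤ lam2 - lam1 + (β - μ₁) * s - θ₁ * Real.log s
          + (μ₂ - β) * t + θ₂ * Real.log t := by
  have gen : ∀ a θ r : ℝ, 0 < a → 0 < θ → 0 < r →
      θ - θ * Real.log (θ / a) ≤ a * r - θ * Real.log r := by
    intro a θ r ha hθ hr
    have h1 := Real.log_le_sub_one_of_pos (x := r / (θ / a)) (by positivity)
    rw [Real.log_div hr.ne' (by positivity)] at h1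
    have h2 := mul_le_mul_of_nonneg_left h1 hθ.le
    have h3 : θ * (r / (θ / a) - 1) = a * r - θ := by field_simp
    rw [h3] at h2
    linarith
  have e1 := gen (β - μ₁) θ₁ s (by linarith) hθ₁ hs
  have e2 := gen (μ₂ - β) (-θ₂) t (by linarith) (by linarith) ht
  have e3 : -θ₂ / (μ₂ - β) = θ₂ / (β - μ₂) := by
    rw [← neg_sub β μ₂, neg_div_neg_eq]
  rw [e3] at e2
  linarith

open Filter Topology Set in
lemma aux_core (Ω : Set E4) (hΩne : Ω.Nonempty) (hΩo : IsOpen Ω)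
    (hΩb : Bornology.IsBounded Ω) (u v : E4 → ℝ)
    (hu2 : ContDiffOn ℝ 2 u Ω) (hv2 : ContDiffOn ℝ 2 v Ω)
    (huc : ContinuousOn u (closure Ω)) (hvc : ContinuousOn v (closure Ω))
    (hup : ∀ x ∈ Ω, 0 < u x) (hvp : ∀ x ∈ Ω, 0 < v x)
    (hu0 : ∀ x ∈ frontier Ω, u x = 0) (M M' c : ℝ) (hc : 0 < c)
    (hM : ∀ x ∈ Ω, ‖fderiv ℝ u x‖ ≤ M) (hM' : ∀ x ∈ Ω, ‖fderiv ℝ v x‖ ≤ M')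
    (hlap : ∀ x ∈ Ω, c * (u x * v x) ≤ v x * lap u x - u x * lap v x) : False := by
  obtain ⟨h, h', C, hh1, hh'c, hhd, hh0, hhle, hhz, hho, hh'0, hh'z, hC⟩ := aux_cutoff
  let e : Fin 4 → E4 := fun i => EuclideanSpace.single i (1 : ℝ)
  have he : ∀ i, ‖e i‖ = 1 := fun i => by simp [e]
  have huA : ∀ x ∈ Ω, ContDiffAt ℝ 2 u x := fun x hx => hu2.contDiffAt (hΩo.mem_nhds hx)
  have hvA : ∀ x ∈ Ω, ContDiffAt ℝ 2 v x := fun x hx => hv2.contDiffAt (hΩo.mem_nhds hx)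
  have hK : IsCompact (closure Ω) := hΩb.isCompact_closure
  have hDA : ∀ w : E4 → ℝ, ∀ x, ContDiffAt ℝ 2 w x → ∀ i,
      ContDiffAt ℝ 1 (fun y => fderiv ℝ w y (e i)) x := by
    intro w x hw i
    exact (hw.fderiv_right (m := 1) (by norm_num)).clm_apply contDiffAt_const
  have hfin : volume Ω < ⊤ := hΩb.measure_lt_top
  obtain ⟨U, hU⟩ := hK.exists_bound_of_continuousOn huc
  obtain ⟨V, hV⟩ := hK.exists_bound_of_continuousOn hvc
  obtain ⟨x0, hx0⟩ := hΩne
  have hM0 : 0 ≤ M := (norm_nonneg _).trans (hM x0 hx0)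
  have hM'0 : 0 ≤ M' := (norm_nonneg _).trans (hM' x0 hx0)
  have hU0 : 0 ≤ U := (norm_nonneg _).trans (hU x0 (subset_closure hx0))
  have hV0 : 0 ≤ V := (norm_nonneg _).trans (hV x0 (subset_closure hx0))
  have hC0 : 0 ≤ C := by simpa using hC 0 le_rfl
  have huΩ : ContinuousOn u Ω := huc.mono subset_closure
  have hvΩ : ContinuousOn v Ω := hvc.mono subset_closure
  -- the lower bound integrand
  let F : ℕ → E4 → ℝ := fun n x => c * (h ((n + 1) * u x) * (u x * v x)) -
    4 * (M * M') * (((n + 1) * u x) * h' ((n + 1) * u x))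
  have hFc : ∀ n, ContinuousOn (F n) Ω := by
    intro n
    have hhc : Continuous h := hh1.continuous
    have a1 : ContinuousOn (fun x => ((n:ℝ) + 1) * u x) Ω := continuousOn_const.mul huΩ
    exact (continuousOn_const.mul ((hhc.comp_continuousOn a1).mul (huΩ.mul hvΩ))).sub
      (continuousOn_const.mul (a1.mul (hh'c.comp_continuousOn a1)))
  have hFb : ∀ n, ∀ x ∈ Ω, ‖F n x‖ ≤ c * (U * V) + 4 * (M * M') * C := by
    intro n x hx
    have b1 : u x ≤ U := (le_abs_self _).trans (hU x (subset_closure hx))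
    have b2 : v x ≤ V := (le_abs_self _).trans (hV x (subset_closure hx))
    have p1 := hup x hx
    have p2 := hvp x hx
    have q1 : 0 ≤ h ((n + 1) * u x) * (u x * v x) := mul_nonneg (hh0 _) (by positivity)
    have q2 : h ((n + 1) * u x) * (u x * v x) ≤ U * V := by
      calc h ((n + 1) * u x) * (u x * v x) ≤ 1 * (u x * v x) := by
            gcongr; exact hhle _
        _ ≤ U * V := by rw [one_mul]; gcongr
    have p3 : 0 ≤ ((n:ℝ) + 1) * u x := by positivity
    have q3 := hC _ p3
    have q4 := mul_nonneg p3 (hh'0 (((n:ℝ) + 1) * u x))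
    have r1 := mul_le_mul_of_nonneg_left q2 hc.le
    have r2 := mul_nonneg hc.le q1
    have r3 := mul_le_mul_of_nonneg_left q3 (by positivity : 0 ≤ 4 * (M * M'))
    have r4 := mul_nonneg (by positivity : 0 ≤ 4 * (M * M')) q4
    have r5 : 0 ≤ c * (U * V) := by positivity
    have r6 : 0 ≤ 4 * (M * M') * C := by positivity
    rw [Real.norm_eq_abs, abs_le]
    constructor <;> simp only [F] <;> linarith
  have hFm : ∀ n, AEStronglyMeasurable (F n) (volume.restrict Ω) := fun n =>
    (hFc n).aestronglyMeasurable hΩo.measurableSet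
  have hconst : ∀ B : ℝ, IntegrableOn (fun _ : E4 => B) Ω := fun B =>
    integrableOn_const hfin.ne
  have hFi : ∀ n, IntegrableOn (F n) Ω := fun n =>
    Integrable.mono' (hconst (c * (U * V) + 4 * (M * M') * C)) (hFm n)
      ((ae_restrict_iff' hΩo.measurableSet).2 (Eventually.of_forall (hFb n)))
  have hlim : Tendsto (fun n => ∫ x in Ω, F n x) atTop (𝓝 (∫ x in Ω, c * (u x * v x))) := by
    refine tendsto_integral_of_dominated_convergence _ hFm
      (hconst (c * (U * V) + 4 * (M * M') * C))
      (fun n => (ae_restrict_iff' hΩo.measurableSet).2 (Eventually.of_forall (hFb n))) ?_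
    refine (ae_restrict_iff' hΩo.measurableSet).2 (Eventually.of_forall fun x hx => ?_)
    refine tendsto_const_nhds.congr' ?_
    obtain ⟨N, hN⟩ := exists_nat_gt (2 / u x)
    filter_upwards [eventually_ge_atTop N] with n hn
    have p1 := hup x hx
    have : 2 < ((n:ℝ) + 1) * u x := by
      have h1 : (N:ℝ) ≤ n := by exact_mod_cast hn
      rw [div_lt_iff₀ p1] at hN
      nlinarith
    simp only [F]
    rw [hho _ this.le, hh'z _ this]; ring
  have hpos : 0 < ∫ x in Ω, c * (u x * v x) := by
    have hint : IntegrableOn (fun x => c * (u x * v x)) Ω := by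
      refine Integrable.mono' (hconst (c * (U * V)))
        ((continuousOn_const.mul (huΩ.mul hvΩ)).aestronglyMeasurable hΩo.measurableSet)
        ((ae_restrict_iff' hΩo.measurableSet).2 (Eventually.of_forall fun x hx => ?_))
      have b1 : u x ≤ U := (le_abs_self _).trans (hU x (subset_closure hx))
      have b2 : v x ≤ V := (le_abs_self _).trans (hV x (subset_closure hx))
      have p1 := hup x hx
      have p2 := hvp x hx
      rw [Real.norm_eq_abs, abs_of_nonneg (by positivity)]
      gcongr
    rw [setIntegral_pos_iff_support_of_nonneg_ae _ hint]
    · have : Ω ⊆ Function.support (fun x => c * (u x * v x)) := fun x hx =>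
        (mul_pos hc (mul_pos (hup x hx) (hvp x hx))).ne'
      rw [inter_eq_self_of_subset_right this]
      exact hΩo.measure_pos _ ⟨x0, hx0⟩
    · exact (ae_restrict_iff' hΩo.measurableSet).2 (Eventually.of_forall fun x hx =>
        (mul_pos hc (mul_pos (hup x hx) (hvp x hx))).le)
  have hle : ∀ n, ∫ x in Ω, F n x ≤ 0 := by
    intro n
    let g : Fin 4 → E4 → ℝ := fun i x => h ((n + 1) * u x) *
      (v x * fderiv ℝ u x (e i) - u x * fderiv ℝ v x (e i))
    let G : Fin 4 → E4 → ℝ := fun i => Ω.indicator (g i)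
    let K : Set E4 := closure Ω ∩ u ⁻¹' (Ici (1 / ((n:ℝ) + 1)))
    have hnp : (0:ℝ) < n + 1 := by positivity
    have hKclosed : IsClosed K := huc.preimage_isClosed_of_isClosed isClosed_closure isClosed_Ici
    have hKcomp : IsCompact K := hK.of_isClosed_subset hKclosed inter_subset_left
    have hKΩ : K ⊆ Ω := by
      rintro x ⟨hx1, hx2⟩
      by_contra hx
      have : x ∈ frontier Ω := by
        rw [frontier, hΩo.interior_eq]; exact ⟨hx1, hx⟩
      have h1 := hu0 x this
      have h2 : 1 / ((n:ℝ) + 1) ≤ u x := hx2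
      have h3 : 0 < 1 / ((n:ℝ) + 1) := by positivity
      linarith
    have hG0 : ∀ i, ∀ x, x ∉ K → G i x = 0 := by
      intro i x hx
      by_cases hxΩ : x ∈ Ω
      · have : u x < 1 / ((n:ℝ) + 1) := by
          by_contra hcon
          exact hx ⟨subset_closure hxΩ, not_lt.1 hcon⟩
        rw [lt_div_iff₀ hnp] at this
        simp only [G, indicator_of_mem hxΩ, g]
        rw [hhz _ (by linarith), zero_mul]
      · simp [G, hxΩ]
    have hGg : ∀ i, ∀ x ∈ Ω, G i =ᶠ[𝓝 x] g i := fun i x hx => by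
      filter_upwards [hΩo.mem_nhds hx] with y hy
      simp [G, hy]
    have hGc : ∀ i, ContDiff ℝ 1 (G i) := by
      intro i
      rw [contDiff_iff_contDiffAt]
      intro x
      by_cases hx : x ∈ Ω
      · refine ContDiffAt.congr_of_eventuallyEq ?_ (hGg i x hx)
        have hu1 := (huA x hx).of_le (m := 1) (by norm_num)
        have hv1 := (hvA x hx).of_le (m := 1) (by norm_num)
        exact (hh1.contDiffAt.comp x (contDiffAt_const.mul hu1)).mul
          ((hv1.mul (hDA u x (huA x hx) i)).sub (hu1.mul (hDA v x (hvA x hx) i)))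
      · refine ContDiffAt.congr_of_eventuallyEq (contDiffAt_const (c := (0:ℝ))) ?_
        filter_upwards [hKclosed.isOpen_compl.mem_nhds (fun hxK => hx (hKΩ hxK))] with y hy
        exact hG0 i y hy
    have hGs : ∀ i, HasCompactSupport (G i) := fun i =>
      HasCompactSupport.intro hKcomp (hG0 i)
    have hzero : ∫ x, ∑ i, fderiv ℝ (G i) x (e i) = 0 := by
      rw [integral_finsetSum _ (fun i _ => (aux_div_zero _ (hGc i) (hGs i) (e i)).1)]
      exact Finset.sum_eq_zero (fun i _ => (aux_div_zero _ (hGc i) (hGs i) (e i)).2)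
    have hint : Integrable (fun x => ∑ i, fderiv ℝ (G i) x (e i)) :=
      integrable_finsetSum _ (fun i _ => (aux_div_zero _ (hGc i) (hGs i) (e i)).1)
    have hset : ∫ x in Ω, ∑ i, fderiv ℝ (G i) x (e i) = 0 := by
      rw [← hzero]
      refine setIntegral_eq_integral_of_forall_compl_eq_zero (fun x hx => ?_)
      refine Finset.sum_eq_zero (fun i _ => ?_)
      have : G i =ᶠ[𝓝 x] fun _ => 0 := by
        filter_upwards [hKclosed.isOpen_compl.mem_nhds (fun hxK => hx (hKΩ hxK))] with y hy
        exact hG0 i y hy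
      rw [this.fderiv_eq]; simp
    rw [← hset]
    refine setIntegral_mono_on (hFi n) hint.integrableOn hΩo.measurableSet (fun x hx => ?_)
    have hder : ∀ i, fderiv ℝ (G i) x (e i) =
        h ((n + 1) * u x) * (v x * fderiv ℝ (fun y => fderiv ℝ u y (e i)) x (e i)
          - u x * fderiv ℝ (fun y => fderiv ℝ v y (e i)) x (e i))
        + h' ((n + 1) * u x) * (n + 1) * (v x * (fderiv ℝ u x (e i)) ^ 2
          - u x * (fderiv ℝ u x (e i) * fderiv ℝ v x (e i))) := by
      intro i
      rw [(hGg i x hx).fderiv_eq]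
      have du := ((huA x hx).differentiableAt (by simp)).hasFDerivAt
      have dv := ((hvA x hx).differentiableAt (by simp)).hasFDerivAt
      have ddu := ((hDA u x (huA x hx) i).differentiableAt (by simp)).hasFDerivAt
      have ddv := ((hDA v x (hvA x hx) i).differentiableAt (by simp)).hasFDerivAt
      have dh := (hhd ((n + 1) * u x)).comp_hasFDerivAt x (du.const_mul ((n:ℝ) + 1))
      have tot := dh.mul ((dv.mul ddu).sub (du.mul ddv))
      have tot' : HasFDerivAt (g i) _ x := tot
      rw [tot'.fderiv]
      simp only [Function.comp, ContinuousLinearMap.add_apply, ContinuousLinearMap.smul_apply,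
        ContinuousLinearMap.sub_apply, smul_eq_mul, Pi.mul_apply, Pi.sub_apply]
      ring
    have hsum : ∑ i, fderiv ℝ (G i) x (e i) = h ((n + 1) * u x) * (v x * lap u x - u x * lap v x)
        + h' ((n + 1) * u x) * (n + 1) * ∑ i, (v x * (fderiv ℝ u x (e i)) ^ 2
          - u x * (fderiv ℝ u x (e i) * fderiv ℝ v x (e i))) := by
      simp only [hder, lap, Finset.sum_add_distrib, Finset.mul_sum, ← Finset.sum_sub_distrib, e]
    have p1 := hup x hx
    have p2 := hvp x hx
    have hterm : ∀ i, -(u x * (M * M')) ≤ v x * (fderiv ℝ u x (e i)) ^ 2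
          - u x * (fderiv ℝ u x (e i) * fderiv ℝ v x (e i)) := by
      intro i
      have a1 : |fderiv ℝ u x (e i)| ≤ M := by
        have := (fderiv ℝ u x).le_opNorm (e i)
        rw [he, mul_one] at this
        exact this.trans (hM x hx)
      have a2 : |fderiv ℝ v x (e i)| ≤ M' := by
        have := (fderiv ℝ v x).le_opNorm (e i)
        rw [he, mul_one] at this
        exact this.trans (hM' x hx)
      have a3 : fderiv ℝ u x (e i) * fderiv ℝ v x (e i) ≤ M * M' := by
        refine (le_abs_self _).trans ?_
        rw [abs_mul]
        gcongr
      have a4 := mul_le_mul_of_nonneg_left a3 p1.le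
      have a5 : 0 ≤ v x * (fderiv ℝ u x (e i)) ^ 2 := by positivity
      linarith
    have hS : -(4 * (u x * (M * M'))) ≤ ∑ i, (v x * (fderiv ℝ u x (e i)) ^ 2
          - u x * (fderiv ℝ u x (e i) * fderiv ℝ v x (e i))) := by
      calc -(4 * (u x * (M * M'))) = ∑ i : Fin 4, -(u x * (M * M')) := by simp
        _ ≤ _ := Finset.sum_le_sum (fun i _ => hterm i)
    rw [hsum]
    have k1 := mul_le_mul_of_nonneg_left (hlap x hx) (hh0 ((n + 1) * u x))
    have k2 := mul_le_mul_of_nonneg_left hS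
      (mul_nonneg (hh'0 (((n:ℝ) + 1) * u x)) hnp.le)
    refine le_trans (le_of_eq ?_) (add_le_add k1 k2)
    simp only [F]; ring
  have := le_of_tendsto' hlim hle
  linarith

/-- Theorem 1.8 of the paper: if `μ₁ < μ₂`, `μ₁ < β < μ₂`, `θ₂ < 0 < θ₁` and
`−θ₁ log(θ₁/(β−μ₁)) + θ₂ log(θ₂/(β−μ₂)) + θ₁ − θ₂ + λ₂ − λ₁ > 0`, then the system has
no positive solution in the bounded domain `Ω`. -/
theorem stmt_19 (Ω : Set E4) (hΩne : Ω.Nonempty) (hΩo : IsOpen Ω)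
    (hΩb : Bornology.IsBounded Ω) (hΩc : IsConnected Ω)
    (lam1 lam2 μ₁ μ₂ θ₁ θ₂ β : ℝ) (hμ : μ₁ < μ₂) (hβ1 : μ₁ < β) (hβ2 : β < μ₂)
    (hθ₂ : θ₂ < 0) (hθ₁ : 0 < θ₁)
    (hcond : -θ₁ * Real.log (θ₁ / (β - μ₁)) + θ₂ * Real.log (θ₂ / (β - μ₂)) +
        θ₁ - θ₂ + lam2 - lam1 > 0) :
    ¬ ∃ u v : E4 → ℝ, IsPositiveSolution Ω lam1 μ₁ θ₁ lam2 μ₂ θ₂ β u v := by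
  rintro ⟨u, v, hu2, hu1, hv2, hv1, hup, hvp, hb, equ, eqv⟩
  obtain ⟨M, hM⟩ := aux_grad_bound Ω hΩo hΩb u hu1
  obtain ⟨M', hM'⟩ := aux_grad_bound Ω hΩo hΩb v hv1
  refine aux_core Ω hΩne hΩo hΩb u v hu2 hv2 hu1.continuousOn hv1.continuousOn hup hvp
    (fun x hx => (hb x hx).1) M M' _ hcond hM hM' (fun x hx => ?_)
  have p1 := hup x hx
  have p2 := hvp x hx
  have e1 := equ x hx
  have e2 := eqv x hx
  have b := aux_bracket lam1 lam2 μ₁ μ₂ θ₁ θ₂ β hβ1 hβ2 hθ₂ hθ₁ (u x ^ 2) (v x ^ 2)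
    (by positivity) (by positivity)
  have k := mul_le_mul_of_nonneg_right b (mul_pos p1 p2).le
  refine k.trans (le_of_eq ?_)
  rw [sq_abs, sq_abs] at e1 e2
  linear_combination (v x) * e1 - (u x) * e2
end
end
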